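/- arXiv:1701.02289 — 4 statements merged into one kernel-verified Lean document; each statement's English description precedes it below -/
import Mathlib

section
/- Let α, β > −1 and let W, s ∈ ℝ be fixed. Then there exists a constant C > 0 such that for all (η,t) ∈ Γ with t ∈ (0,π] and all θ, φ ∈ (0,π) with θ+η ∈ (0,π), one has Υ_{W,s}^{α,β}(t,θ+η,φ) ≤ C · Υ_{W,s}^{α,β}(t,θ,φ). -/
open Real Set MeasureTheory

/-- `q(θ,φ,u,v) = 1 − u sin(θ/2) sin(φ/2) − v cos(θ/2) cos(φ/2)`. -/
noncomputable def q (θ φ u v : ℝ) : ℝ :=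
  1 - u * Real.sin (θ / 2) * Real.sin (φ / 2) - v * Real.cos (θ / 2) * Real.cos (φ / 2)

/-- The measure `Π_a` on `[−1,1]`: for `a > −1/2` it has density
`Γ(a+1)/(√π Γ(a+1/2)) (1−u²)^{a−1/2}`, and `Π_{−1/2}` is `(δ_{−1}+δ_1)/2`. -/
noncomputable def jacobiPi (a : ℝ) : Measure ℝ :=
  if a = -(1 / 2) then
    (2 : ENNReal)⁻¹ • (Measure.dirac (-1) + Measure.dirac 1)
  else
    (volume.restrict (Icc (-1 : ℝ) 1)).withDensity
      (fun u => ENNReal.ofReal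
        (Real.Gamma (a + 1) / (Real.sqrt π * Real.Gamma (a + 1 / 2)) * (1 - u ^ 2) ^ (a - 1 / 2)))

/-- `Π_a^K`: equals `Π_{−1/2}` if `K = 0` and `Π_{a+1}` if `K = 1`. -/
noncomputable def jacobiPiK (a : ℝ) (K : ℕ) : Measure ℝ :=
  if K = 0 then jacobiPi (-(1 / 2)) else jacobiPi (a + 1)

/-- The function `Υ_{W,s}^{α,β}(t,θ,φ)`, defined by cases according to the
positions of `α, β` relative to `−1/2`. -/
noncomputable def Ups (α β W s t θ φ : ℝ) : ℝ :=
  if -(1 / 2) ≤ α then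
    if -(1 / 2) ≤ β then
      ∫ u, ∫ v, (t ^ 2 + q θ φ u v) ^ (-(α + β + 3 / 2 + W / 4 + s / 2))
        ∂(jacobiPi β) ∂(jacobiPi α)
    else
      1 + ∑ R ∈ Finset.range 2, ∑ r ∈ Finset.range 3,
        (Real.cos (θ / 2) + Real.cos (φ / 2)) ^ (R * r) *
        ∫ u, ∫ v,
          (t ^ 2 + q θ φ u v) ^ (-(α + β + 3 / 2 + W / 4 + ((R * r : ℕ) : ℝ) / 2 + s / 2))
          ∂(jacobiPiK β R) ∂(jacobiPi α)
  else
    if -(1 / 2) ≤ β then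
      1 + ∑ K ∈ Finset.range 2, ∑ k ∈ Finset.range 3,
        (Real.sin (θ / 2) + Real.sin (φ / 2)) ^ (K * k) *
        ∫ u, ∫ v,
          (t ^ 2 + q θ φ u v) ^ (-(α + β + 3 / 2 + W / 4 + ((K * k : ℕ) : ℝ) / 2 + s / 2))
          ∂(jacobiPi β) ∂(jacobiPiK α K)
    else
      1 + ∑ K ∈ Finset.range 2, ∑ R ∈ Finset.range 2, ∑ k ∈ Finset.range 3, ∑ r ∈ Finset.range 3,
        (Real.sin (θ / 2) + Real.sin (φ / 2)) ^ (K * k) *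
        (Real.cos (θ / 2) + Real.cos (φ / 2)) ^ (R * r) *
        ∫ u, ∫ v,
          (t ^ 2 + q θ φ u v) ^
            (-(α + β + 3 / 2 + W / 4 + ((K * k : ℕ) : ℝ) / 2 + ((R * r : ℕ) : ℝ) / 2 + s / 2))
          ∂(jacobiPiK β R) ∂(jacobiPiK α K)

/-- One-variable form of the comparison of `q` at nearby angles: here `a ^ 2 + b ^ 2 ≤ 1`. -/
lemma one_sub_sin_cos_add_le {a b : ℝ} (hab : a ^ 2 + b ^ 2 ≤ 1) (x h : ℝ) :
    1 - a * sin (x + h) - b * cos (x + h) ≤ 2 * (1 - a * sin x - b * cos x) + h ^ 2 := by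
  set M := a * sin x + b * cos x with hM
  set D := a * cos x - b * sin x with hD
  have hMD : M ^ 2 + D ^ 2 ≤ 1 := by
    have : M ^ 2 + D ^ 2 = (a ^ 2 + b ^ 2) * (sin x ^ 2 + cos x ^ 2) := by rw [hM, hD]; ring
    rwa [this, sin_sq_add_cos_sq, mul_one]
  have e1 : 1 - a * sin (x + h) - b * cos (x + h) =
      (1 - cos h) + (1 - M) * cos h - D * sin h := by
    rw [sin_add, cos_add, hM, hD]; ring
  have e2 : 1 - a * sin x - b * cos x = 1 - M := by rw [hM]; ring
  have hM1 : 0 ≤ 1 - M := by nlinarith [sq_nonneg D]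
  have hc : 1 - h ^ 2 / 2 ≤ cos h := one_sub_sq_div_two_le_cos
  have hs : sin h ^ 2 ≤ h ^ 2 := sq_le_sq.mpr abs_sin_le_abs
  rw [e1, e2]
  nlinarith [mul_le_mul_of_nonneg_left (cos_le_one h) hM1, sq_nonneg (D + sin h),
    sq_nonneg (1 - M)]

lemma sq_mul_sin_add_sq_mul_cos_le {u v : ℝ} (hu : u ∈ Icc (-1 : ℝ) 1)
    (hv : v ∈ Icc (-1 : ℝ) 1) (y : ℝ) : (u * sin y) ^ 2 + (v * cos y) ^ 2 ≤ 1 := by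
  have hu2 : u ^ 2 ≤ 1 := by nlinarith [hu.1, hu.2]
  have hv2 : v ^ 2 ≤ 1 := by nlinarith [hv.1, hv.2]
  nlinarith [sin_sq_add_cos_sq y, mul_le_mul_of_nonneg_right hu2 (sq_nonneg (sin y)),
    mul_le_mul_of_nonneg_right hv2 (sq_nonneg (cos y))]

lemma q_add_le {u v : ℝ} (hu : u ∈ Icc (-1 : ℝ) 1) (hv : v ∈ Icc (-1 : ℝ) 1) (θ η φ : ℝ) :
    q (θ + η) φ u v ≤ 2 * q θ φ u v + (η / 2) ^ 2 := by
  have h := one_sub_sin_cos_add_le (sq_mul_sin_add_sq_mul_cos_le hu hv (φ / 2)) (θ / 2) (η / 2)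
  rw [← add_div] at h
  unfold q
  linarith

lemma q_nonneg {u v : ℝ} (hu : u ∈ Icc (-1 : ℝ) 1) (hv : v ∈ Icc (-1 : ℝ) 1) (θ φ : ℝ) :
    0 ≤ q θ φ u v := by
  have h := q_add_le hu hv θ 0 φ
  rw [add_zero] at h
  linarith

lemma q_le_three {u v : ℝ} (hu : u ∈ Icc (-1 : ℝ) 1) (hv : v ∈ Icc (-1 : ℝ) 1) (θ φ : ℝ) :
    q θ φ u v ≤ 3 := by
  have h (w x y : ℝ) (hw : w ∈ Icc (-1 : ℝ) 1) (hx : |x| ≤ 1) (hy : |y| ≤ 1) :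
      -1 ≤ w * x * y := by
    refine (abs_le.mp ?_).1
    rw [abs_mul, abs_mul]
    exact mul_le_one₀ (mul_le_one₀ (abs_le.mpr hw) (abs_nonneg _) hx) (abs_nonneg _) hy
  have h1 := h u _ _ hu (abs_sin_le_one (θ / 2)) (abs_sin_le_one (φ / 2))
  have h2 := h v _ _ hv (abs_cos_le_one (θ / 2)) (abs_cos_le_one (φ / 2))
  unfold q
  linarith

lemma sq_add_q_add_le {u v η t : ℝ} (hu : u ∈ Icc (-1 : ℝ) 1) (hv : v ∈ Icc (-1 : ℝ) 1)
    (hη : |η| < t) (θ φ : ℝ) :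
    t ^ 2 + q (θ + η) φ u v ≤ 2 * (t ^ 2 + q θ φ u v) := by
  have h := q_add_le hu hv θ η φ
  have h2 : η ^ 2 ≤ t ^ 2 := sq_le_sq' (by linarith [neg_abs_le η]) ((le_abs_self η).trans hη.le)
  nlinarith

lemma rpow_le_two_rpow_abs_mul_rpow {x y : ℝ} (hx : 0 < x) (hy : 0 < y) (hxy : x ≤ 2 * y)
    (hyx : y ≤ 2 * x) (p : ℝ) : x ^ p ≤ 2 ^ |p| * y ^ p := by
  rcases le_total 0 p with hp | hp
  · rw [abs_of_nonneg hp, ← mul_rpow zero_le_two hy.le]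
    exact rpow_le_rpow hx.le hxy hp
  · have h : (2 * x) ^ p ≤ y ^ p := rpow_le_rpow_of_nonpos hy hyx hp
    rw [mul_rpow zero_le_two hx.le] at h
    rw [abs_of_nonpos hp, rpow_neg zero_le_two]
    rw [inv_mul_eq_div, le_div_iff₀ (by positivity)]
    linarith

lemma rpow_le_rpow_add_rpow_of_mem_Icc {m M x : ℝ} (hm : 0 < m) (hx : x ∈ Icc m M) (p : ℝ) :
    x ^ p ≤ m ^ p + M ^ p := by
  have hx0 : 0 < x := hm.trans_le hx.1
  rcases le_total 0 p with hp | hp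
  · exact (rpow_le_rpow hx0.le hx.2 hp).trans (le_add_of_nonneg_left (by positivity))
  · exact (rpow_le_rpow_of_nonpos hm hx.1 hp).trans
      (le_add_of_nonneg_right (rpow_nonneg (hx0.le.trans hx.2) p))

lemma integrableOn_one_sub_sq_rpow {p : ℝ} (hp : -1 < p) :
    IntegrableOn (fun u : ℝ => (1 - u ^ 2) ^ p) (Icc (-1) 1) := by
  have h0 : IntervalIntegrable (fun x : ℝ => x ^ p) volume 0 2 :=
    intervalIntegral.intervalIntegrable_rpow' hp
  have h1 : IntegrableOn (fun u : ℝ => (1 - u) ^ p) (Icc (-1) 1) := by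
    have := (h0.comp_sub_left 1).symm
    norm_num at this
    rwa [intervalIntegrable_iff_integrableOn_Icc_of_le (by norm_num)] at this
  have h2 : IntegrableOn (fun u : ℝ => (1 + u) ^ p) (Icc (-1) 1) := by
    have := h0.comp_add_left 1
    norm_num at this
    rwa [intervalIntegrable_iff_integrableOn_Icc_of_le (by norm_num)] at this
  have h3 : IntegrableOn (fun _ : ℝ => (1 : ℝ)) (Icc (-1) 1) := by simp
  refine ((h1.add h2).add h3).mono' (Measurable.aestronglyMeasurable (by fun_prop)) ?_
  filter_upwards [ae_restrict_mem measurableSet_Icc] with u hu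
  obtain ⟨hl, hr⟩ := hu
  have hs : 0 ≤ 1 - u ^ 2 := by nlinarith
  have a1 : 0 ≤ (1 - u) ^ p := rpow_nonneg (by linarith) p
  have a2 : 0 ≤ (1 + u) ^ p := rpow_nonneg (by linarith) p
  simp only [Pi.add_apply, norm_eq_abs]
  rw [abs_of_nonneg (rpow_nonneg hs p)]
  rcases le_or_gt 0 p with h | h
  · linarith [rpow_le_one hs (by nlinarith) h]
  · rcases hs.eq_or_lt with h' | h'
    · rw [← h', zero_rpow h.ne]; linarith
    · rcases le_total 0 u with hu | hu
      · linarith [rpow_le_rpow_of_nonpos (x := 1 - u) (y := 1 - u ^ 2) (z := p)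
          (by nlinarith) (by nlinarith) h.le]
      · linarith [rpow_le_rpow_of_nonpos (x := 1 + u) (y := 1 - u ^ 2) (z := p)
          (by nlinarith) (by nlinarith) h.le]

lemma isFiniteMeasure_jacobiPi {a : ℝ} (ha : -(1 / 2) ≤ a) : IsFiniteMeasure (jacobiPi a) := by
  unfold jacobiPi
  split_ifs with h
  · exact Measure.smul_finite _ (by simp)
  · have hlt : -1 < a - 1 / 2 := by
      have := lt_of_le_of_ne ha (Ne.symm h)
      linarith
    exact isFiniteMeasure_withDensity_ofReal
      ((integrableOn_one_sub_sq_rpow hlt).const_mul _).hasFiniteIntegral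

lemma ae_jacobiPi_mem_Icc (a : ℝ) : ∀ᵐ u ∂(jacobiPi a), u ∈ Icc (-1 : ℝ) 1 := by
  unfold jacobiPi
  split_ifs with h
  · refine Measure.ae_smul_measure ?_ _
    rw [ae_add_measure_iff]
    simp [ae_dirac_eq]
  · exact (withDensity_absolutelyContinuous _ _).ae_le (ae_restrict_mem measurableSet_Icc)

lemma isFiniteMeasure_jacobiPiK {a : ℝ} (ha : -1 < a) (K : ℕ) :
    IsFiniteMeasure (jacobiPiK a K) := by
  unfold jacobiPiK
  split_ifs
  · exact isFiniteMeasure_jacobiPi le_rfl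
  · exact isFiniteMeasure_jacobiPi (by linarith)

lemma ae_jacobiPiK_mem_Icc (a : ℝ) (K : ℕ) : ∀ᵐ u ∂(jacobiPiK a K), u ∈ Icc (-1 : ℝ) 1 := by
  unfold jacobiPiK
  split_ifs <;> exact ae_jacobiPi_mem_Icc _

/-- The general summand of `Ups`, for arbitrary measures in place of the `Π`'s. -/
noncomputable def upsTerm (μ ν : Measure ℝ) (A s : ℝ) (m n : ℕ) (t θ φ : ℝ) : ℝ :=
  (sin (θ / 2) + sin (φ / 2)) ^ m * (cos (θ / 2) + cos (φ / 2)) ^ n *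
    ∫ u, ∫ v, (t ^ 2 + q θ φ u v) ^ (-(A + (m : ℝ) / 2 + (n : ℝ) / 2 + s / 2)) ∂ν ∂μ

lemma ae_prod_mem_Icc {μ ν : Measure ℝ} (hμ : ∀ᵐ u ∂μ, u ∈ Icc (-1 : ℝ) 1)
    (hν : ∀ᵐ v ∂ν, v ∈ Icc (-1 : ℝ) 1) :
    ∀ᵐ z ∂(μ.prod ν), z.1 ∈ Icc (-1 : ℝ) 1 ∧ z.2 ∈ Icc (-1 : ℝ) 1 :=
  (Measure.quasiMeasurePreserving_fst.ae hμ).and (Measure.quasiMeasurePreserving_snd.ae hν)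

section Kernel

variable {μ ν : Measure ℝ} [IsFiniteMeasure μ] [IsFiniteMeasure ν]

lemma integrable_sq_add_q_rpow (hμ : ∀ᵐ u ∂μ, u ∈ Icc (-1 : ℝ) 1)
    (hν : ∀ᵐ v ∂ν, v ∈ Icc (-1 : ℝ) 1) {t : ℝ} (ht : 0 < t) (θ φ p : ℝ) :
    Integrable (fun z : ℝ × ℝ => (t ^ 2 + q θ φ z.1 z.2) ^ p) (μ.prod ν) := by
  refine Integrable.mono' (integrable_const ((t ^ 2) ^ p + (t ^ 2 + 3) ^ p)) ?_ ?_
  · unfold q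
    exact Measurable.aestronglyMeasurable (by fun_prop)
  · filter_upwards [ae_prod_mem_Icc hμ hν] with z hz
    have h0 := q_nonneg hz.1 hz.2 θ φ
    have h3 := q_le_three hz.1 hz.2 θ φ
    rw [norm_of_nonneg (rpow_nonneg (by positivity) p)]
    exact rpow_le_rpow_add_rpow_of_mem_Icc (by positivity) ⟨by linarith, by linarith⟩ p

/-- Iterated integrals of powers of `t ^ 2 + q` are compared by comparing the integrands. -/
lemma iterated_integral_rpow_le (hμ : ∀ᵐ u ∂μ, u ∈ Icc (-1 : ℝ) 1)
    (hν : ∀ᵐ v ∂ν, v ∈ Icc (-1 : ℝ) 1) {t : ℝ} (ht : 0 < t) {θ θ' φ p p' c c' : ℝ}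
    (h : ∀ u ∈ Icc (-1 : ℝ) 1, ∀ v ∈ Icc (-1 : ℝ) 1,
      c' * (t ^ 2 + q θ' φ u v) ^ p' ≤ c * (t ^ 2 + q θ φ u v) ^ p) :
    c' * ∫ u, ∫ v, (t ^ 2 + q θ' φ u v) ^ p' ∂ν ∂μ ≤
      c * ∫ u, ∫ v, (t ^ 2 + q θ φ u v) ^ p ∂ν ∂μ := by
  have i' := integrable_sq_add_q_rpow hμ hν ht θ' φ p'
  have i := integrable_sq_add_q_rpow hμ hν ht θ φ p
  rw [← integral_prod _ i', ← integral_prod _ i, ← integral_const_mul, ← integral_const_mul]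
  refine integral_mono_ae (i'.const_mul _) (i.const_mul _) ?_
  filter_upwards [ae_prod_mem_Icc hμ hν] with z hz
  exact h _ hz.1 _ hz.2

lemma iterated_integral_rpow_nonneg (hμ : ∀ᵐ u ∂μ, u ∈ Icc (-1 : ℝ) 1)
    (hν : ∀ᵐ v ∂ν, v ∈ Icc (-1 : ℝ) 1) {t : ℝ} (ht : 0 < t) (θ φ p : ℝ) :
    0 ≤ ∫ u, ∫ v, (t ^ 2 + q θ φ u v) ^ p ∂ν ∂μ := by
  have := iterated_integral_rpow_le hμ hν ht (θ := θ) (θ' := θ) (φ := φ) (p := p) (p' := p)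
    (c := 1) (c' := 0) fun u hu v hv => by
      have := q_nonneg hu hv θ φ
      rw [zero_mul, one_mul]
      positivity
  simpa using this

lemma iterated_integral_rpow_add_le (hμ : ∀ᵐ u ∂μ, u ∈ Icc (-1 : ℝ) 1)
    (hν : ∀ᵐ v ∂ν, v ∈ Icc (-1 : ℝ) 1) {η t : ℝ} (hη : |η| < t) (θ φ p : ℝ) :
    ∫ u, ∫ v, (t ^ 2 + q (θ + η) φ u v) ^ p ∂ν ∂μ ≤
      2 ^ |p| * ∫ u, ∫ v, (t ^ 2 + q θ φ u v) ^ p ∂ν ∂μ := by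
  have ht : 0 < t := (abs_nonneg η).trans_lt hη
  rw [← one_mul (∫ u, ∫ v, (t ^ 2 + q (θ + η) φ u v) ^ p ∂ν ∂μ)]
  refine iterated_integral_rpow_le hμ hν ht fun u hu v hv => ?_
  have h0 := q_nonneg hu hv θ φ
  have h0' := q_nonneg hu hv (θ + η) φ
  rw [one_mul]
  refine rpow_le_two_rpow_abs_mul_rpow (by positivity) (by positivity)
    (sq_add_q_add_le hu hv hη θ φ) ?_ p
  have h := sq_add_q_add_le hu hv (η := -η) (by rwa [abs_neg]) (θ + η) φ
  rwa [add_neg_cancel_right] at h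

lemma pow_mul_iterated_integral_rpow_le (hμ : ∀ᵐ u ∂μ, u ∈ Icc (-1 : ℝ) 1)
    (hν : ∀ᵐ v ∂ν, v ∈ Icc (-1 : ℝ) 1) {t : ℝ} (ht : 0 < t) (θ φ p : ℝ) (m : ℕ) :
    t ^ m * ∫ u, ∫ v, (t ^ 2 + q θ φ u v) ^ (p - (m : ℝ) / 2) ∂ν ∂μ ≤
      ∫ u, ∫ v, (t ^ 2 + q θ φ u v) ^ p ∂ν ∂μ := by
  rw [← one_mul (∫ u, ∫ v, (t ^ 2 + q θ φ u v) ^ p ∂ν ∂μ)]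
  refine iterated_integral_rpow_le hμ hν ht fun u hu v hv => ?_
  have h0 := q_nonneg hu hv θ φ
  have hpos : 0 < t ^ 2 + q θ φ u v := by positivity
  have hm : t ^ m ≤ (t ^ 2 + q θ φ u v) ^ ((m : ℝ) / 2) := by
    have e : (t ^ 2) ^ ((m : ℝ) / 2) = t ^ m := by
      rw [← rpow_natCast t 2, ← rpow_mul ht.le, ← rpow_natCast]
      congr 1
      push_cast
      ring
    rw [← e]
    exact rpow_le_rpow (by positivity) (by linarith) (by positivity)
  rw [one_mul, rpow_sub hpos, mul_div_assoc', div_le_iff₀ (by positivity), mul_comm]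
  gcongr

end Kernel

lemma sin_half_nonneg {θ : ℝ} (h : θ ∈ Ioo (0 : ℝ) π) : 0 ≤ sin (θ / 2) :=
  sin_nonneg_of_nonneg_of_le_pi (by linarith [h.1]) (by linarith [h.1, h.2])

lemma cos_half_nonneg {θ : ℝ} (h : θ ∈ Ioo (0 : ℝ) π) : 0 ≤ cos (θ / 2) :=
  cos_nonneg_of_neg_pi_div_two_le_of_le (by linarith [h.1, pi_pos]) (by linarith [h.2])

lemma sin_half_add_le {η t : ℝ} (hη : |η| < t) (θ : ℝ) :
    sin ((θ + η) / 2) ≤ sin (θ / 2) + t := by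
  have h := abs_sin_sub_sin_le ((θ + η) / 2) (θ / 2)
  have e : (θ + η) / 2 - θ / 2 = η / 2 := by ring
  rw [e, abs_div, abs_two] at h
  linarith [le_abs_self (sin ((θ + η) / 2) - sin (θ / 2)), abs_nonneg η]

lemma cos_half_add_le {η t : ℝ} (hη : |η| < t) (θ : ℝ) :
    cos ((θ + η) / 2) ≤ cos (θ / 2) + t := by
  have h := abs_cos_sub_cos_le ((θ + η) / 2) (θ / 2)
  have e : (θ + η) / 2 - θ / 2 = η / 2 := by ring
  rw [e, abs_div, abs_two] at h
  linarith [le_abs_self (cos ((θ + η) / 2) - cos (θ / 2)), abs_nonneg η]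

lemma pow_le_two_pow_mul_add_pow {x y t : ℝ} (hx : 0 ≤ x) (hy : 0 ≤ y) (ht : 0 ≤ t)
    (h : x ≤ y + t) (m : ℕ) : x ^ m ≤ 2 ^ m * (y ^ m + t ^ m) := by
  calc x ^ m ≤ (y + t) ^ m := by gcongr
    _ ≤ 2 ^ (m - 1) * (y ^ m + t ^ m) := add_pow_le hy ht m
    _ ≤ 2 ^ m * (y ^ m + t ^ m) := by gcongr <;> norm_num

/-- `f` at the shifted angle `θ + η` is bounded by a constant multiple of `g` at `θ`,
uniformly over `|η| < t`. -/
def ShiftBounded (f g : ℝ → ℝ → ℝ → ℝ) : Prop :=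
  ∃ D : ℝ, 0 < D ∧ ∀ η t θ φ : ℝ, |η| < t → θ ∈ Ioo (0 : ℝ) π → φ ∈ Ioo (0 : ℝ) π →
    θ + η ∈ Ioo (0 : ℝ) π → f t (θ + η) φ ≤ D * g t θ φ

lemma ShiftBounded.add {f f' g : ℝ → ℝ → ℝ → ℝ} (hf : ShiftBounded f g)
    (hf' : ShiftBounded f' g) : ShiftBounded (fun t θ φ => f t θ φ + f' t θ φ) g := by
  obtain ⟨D, hD, h⟩ := hf
  obtain ⟨D', hD', h'⟩ := hf'
  refine ⟨D + D', add_pos hD hD', fun η t θ φ h1 h2 h3 h4 => ?_⟩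
  rw [add_mul]
  exact add_le_add (h η t θ φ h1 h2 h3 h4) (h' η t θ φ h1 h2 h3 h4)

lemma ShiftBounded.sum {ι : Type*} {I : Finset ι} (hI : I.Nonempty) {f : ι → ℝ → ℝ → ℝ → ℝ}
    {g : ℝ → ℝ → ℝ → ℝ} (hf : ∀ i ∈ I, ShiftBounded (f i) g) :
    ShiftBounded (fun t θ φ => ∑ i ∈ I, f i t θ φ) g := by
  induction hI using Finset.Nonempty.cons_induction with
  | singleton i => simpa using hf i (Finset.mem_singleton_self i)
  | cons i I hi _ ih =>
    simp only [Finset.sum_cons]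
    exact (hf i (Finset.mem_cons_self i I)).add
      (ih fun j hj => hf j (Finset.mem_cons_of_mem hj))

lemma upsTerm_nonneg {μ ν : Measure ℝ} [IsFiniteMeasure μ] [IsFiniteMeasure ν]
    (hμ : ∀ᵐ u ∂μ, u ∈ Icc (-1 : ℝ) 1) (hν : ∀ᵐ v ∂ν, v ∈ Icc (-1 : ℝ) 1) (A s : ℝ) (m n : ℕ)
    {t θ φ : ℝ} (ht : 0 < t) (hθ : θ ∈ Ioo (0 : ℝ) π) (hφ : φ ∈ Ioo (0 : ℝ) π) :
    0 ≤ upsTerm μ ν A s m n t θ φ := by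
  have := sin_half_nonneg hθ
  have := sin_half_nonneg hφ
  have := cos_half_nonneg hθ
  have := cos_half_nonneg hφ
  have := iterated_integral_rpow_nonneg hμ hν ht θ φ
    (-(A + (m : ℝ) / 2 + (n : ℝ) / 2 + s / 2))
  unfold upsTerm
  positivity

lemma shiftBounded_upsTerm {μ ν : Measure ℝ} [IsFiniteMeasure μ] [IsFiniteMeasure ν]
    (hμ : ∀ᵐ u ∂μ, u ∈ Icc (-1 : ℝ) 1) (hν : ∀ᵐ v ∂ν, v ∈ Icc (-1 : ℝ) 1) (A s : ℝ) (m n : ℕ)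
    {g : ℝ → ℝ → ℝ → ℝ}
    (hg : ∀ t θ φ : ℝ, 0 < t → θ ∈ Ioo (0 : ℝ) π → φ ∈ Ioo (0 : ℝ) π →
      upsTerm μ ν A s m n t θ φ ≤ g t θ φ ∧ upsTerm μ ν A s m 0 t θ φ ≤ g t θ φ ∧
      upsTerm μ ν A s 0 n t θ φ ≤ g t θ φ ∧ upsTerm μ ν A s 0 0 t θ φ ≤ g t θ φ) :
    ShiftBounded (upsTerm μ ν A s m n) g := by
  set p : ℝ := -(A + (m : ℝ) / 2 + (n : ℝ) / 2 + s / 2) with hp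
  refine ⟨2 ^ m * 2 ^ n * 2 ^ |p| * 4, by positivity, fun η t θ φ hη hθ hφ hθη => ?_⟩
  have ht : 0 < t := (abs_nonneg η).trans_lt hη
  obtain ⟨g1, g2, g3, g4⟩ := hg t θ φ ht hθ hφ
  have sθ := sin_half_nonneg hθ
  have sφ := sin_half_nonneg hφ
  have sη := sin_half_nonneg hθη
  have cθ := cos_half_nonneg hθ
  have cφ := cos_half_nonneg hφ
  have cη := cos_half_nonneg hθη
  have hS := pow_le_two_pow_mul_add_pow (add_nonneg sη sφ) (add_nonneg sθ sφ) ht.le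
    (by linarith [sin_half_add_le hη θ]) m
  have hC := pow_le_two_pow_mul_add_pow (add_nonneg cη cφ) (add_nonneg cθ cφ) ht.le
    (by linarith [cos_half_add_le hη θ]) n
  have hJ := iterated_integral_rpow_add_le hμ hν hη θ φ p
  have hJ0 := iterated_integral_rpow_nonneg hμ hν ht θ φ p
  have hJ0' := iterated_integral_rpow_nonneg hμ hν ht (θ + η) φ p
  have hm := pow_mul_iterated_integral_rpow_le hμ hν ht θ φ (p + (m : ℝ) / 2) m
  have hn := pow_mul_iterated_integral_rpow_le hμ hν ht θ φ (p + (n : ℝ) / 2) n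
  have hmn := pow_mul_iterated_integral_rpow_le hμ hν ht θ φ (p + (m : ℝ) / 2 + (n : ℝ) / 2)
    (m + n)
  rw [show p + (m : ℝ) / 2 - (m : ℝ) / 2 = p by ring] at hm
  rw [show p + (n : ℝ) / 2 - (n : ℝ) / 2 = p by ring] at hn
  rw [show p + (m : ℝ) / 2 + (n : ℝ) / 2 - ((m + n : ℕ) : ℝ) / 2 = p by push_cast; ring,
    pow_add] at hmn
  unfold upsTerm at g1 g2 g3 g4 ⊢
  rw [← hp] at g1 ⊢
  rw [show -(A + (m : ℝ) / 2 + ((0 : ℕ) : ℝ) / 2 + s / 2) = p + (n : ℝ) / 2 by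
    rw [hp]; push_cast; ring] at g2
  rw [show -(A + ((0 : ℕ) : ℝ) / 2 + (n : ℝ) / 2 + s / 2) = p + (m : ℝ) / 2 by
    rw [hp]; push_cast; ring] at g3
  rw [show -(A + ((0 : ℕ) : ℝ) / 2 + ((0 : ℕ) : ℝ) / 2 + s / 2) =
    p + (m : ℝ) / 2 + (n : ℝ) / 2 by rw [hp]; push_cast; ring] at g4
  rw [pow_zero, mul_one] at g2
  rw [pow_zero, one_mul] at g3
  rw [pow_zero, pow_zero, mul_one, one_mul] at g4
  set J := ∫ u, ∫ v, (t ^ 2 + q θ φ u v) ^ p ∂ν ∂μ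
  set S := sin (θ / 2) + sin (φ / 2)
  set C := cos (θ / 2) + cos (φ / 2)
  have hS0 : 0 ≤ S := add_nonneg sθ sφ
  have hC0 : 0 ≤ C := add_nonneg cθ cφ
  have k2 : S ^ m * (t ^ n * J) ≤ g t θ φ :=
    (mul_le_mul_of_nonneg_left hn (by positivity)).trans g2
  have k3 : C ^ n * (t ^ m * J) ≤ g t θ φ :=
    (mul_le_mul_of_nonneg_left hm (by positivity)).trans g3
  have k4 := hmn.trans g4
  calc _ ≤ (2 ^ m * (S ^ m + t ^ m)) * (2 ^ n * (C ^ n + t ^ n)) * (2 ^ |p| * J) := by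
        gcongr
    _ = 2 ^ m * 2 ^ n * 2 ^ |p| * (S ^ m * C ^ n * J + S ^ m * (t ^ n * J) +
          C ^ n * (t ^ m * J) + t ^ m * t ^ n * J) := by ring
    _ ≤ 2 ^ m * 2 ^ n * 2 ^ |p| * (4 * g t θ φ) := by
        gcongr
        linarith
    _ = _ := by ring

lemma Finset.le_sum_sum_of_nonneg {ι κ : Type*} {I : Finset ι} {J : Finset κ} {f : ι → κ → ℝ}
    (hf : ∀ i ∈ I, ∀ j ∈ J, 0 ≤ f i j) {i : ι} {j : κ} (hi : i ∈ I) (hj : j ∈ J) :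
    f i j ≤ ∑ i ∈ I, ∑ j ∈ J, f i j :=
  (Finset.single_le_sum (hf i hi) hj).trans
    (Finset.single_le_sum (f := fun i => ∑ j ∈ J, f i j)
      (fun i hi => Finset.sum_nonneg (hf i hi)) hi)

/-- A two-parameter family of sums of terms is controlled by one plus itself, provided the family
of exponents `K * k`, `R * r` has the shape used in `Ups`. -/
lemma shiftBounded_one_add_sum {I I' : Finset ℕ} (hI : I.Nonempty)
    (hI' : I'.Nonempty) {N N' : ℕ} (μ ν : ℕ → Measure ℝ)
    (hμf : ∀ K, IsFiniteMeasure (μ K)) (hνf : ∀ R, IsFiniteMeasure (ν R))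
    (hμ : ∀ K, ∀ᵐ u ∂(μ K), u ∈ Icc (-1 : ℝ) 1) (hν : ∀ R, ∀ᵐ v ∂(ν R), v ∈ Icc (-1 : ℝ) 1)
    (A s : ℝ) :
    ShiftBounded
      (fun t θ φ => 1 + ∑ K ∈ I, ∑ R ∈ I', ∑ k ∈ Finset.range (N + 1),
        ∑ r ∈ Finset.range (N' + 1), upsTerm (μ K) (ν R) A s (K * k) (R * r) t θ φ)
      (fun t θ φ => 1 + ∑ K ∈ I, ∑ R ∈ I', ∑ k ∈ Finset.range (N + 1),
        ∑ r ∈ Finset.range (N' + 1), upsTerm (μ K) (ν R) A s (K * k) (R * r) t θ φ) := by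
  have hnn (K R m n : ℕ) {t θ φ : ℝ} (ht : 0 < t) (hθ : θ ∈ Ioo (0 : ℝ) π)
      (hφ : φ ∈ Ioo (0 : ℝ) π) : 0 ≤ upsTerm (μ K) (ν R) A s m n t θ φ :=
    upsTerm_nonneg (hμ K) (hν R) A s m n ht hθ hφ
  have hle (K R k r : ℕ) (hK : K ∈ I) (hR : R ∈ I') (hk : k ∈ Finset.range (N + 1))
      (hr : r ∈ Finset.range (N' + 1)) {t θ φ : ℝ} (ht : 0 < t) (hθ : θ ∈ Ioo (0 : ℝ) π)
      (hφ : φ ∈ Ioo (0 : ℝ) π) : upsTerm (μ K) (ν R) A s (K * k) (R * r) t θ φ ≤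
        1 + ∑ K ∈ I, ∑ R ∈ I', ∑ k ∈ Finset.range (N + 1),
          ∑ r ∈ Finset.range (N' + 1), upsTerm (μ K) (ν R) A s (K * k) (R * r) t θ φ := by
    have h1 := Finset.le_sum_sum_of_nonneg
      (f := fun k r => upsTerm (μ K) (ν R) A s (K * k) (R * r) t θ φ)
      (fun k _ r _ => hnn K R (K * k) (R * r) ht hθ hφ) hk hr
    have h2 := Finset.le_sum_sum_of_nonneg (I := I) (J := I')
      (f := fun K R => ∑ k ∈ Finset.range (N + 1), ∑ r ∈ Finset.range (N' + 1),
        upsTerm (μ K) (ν R) A s (K * k) (R * r) t θ φ)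
      (fun K _ R _ => Finset.sum_nonneg fun k _ => Finset.sum_nonneg fun r _ =>
        hnn K R (K * k) (R * r) ht hθ hφ) hK hR
    linarith
  refine ShiftBounded.add ⟨1, one_pos, fun η t θ φ hη hθ hφ _ => ?_⟩ ?_
  · have ht : 0 < t := (abs_nonneg η).trans_lt hη
    rw [one_mul]
    refine le_add_of_nonneg_right (Finset.sum_nonneg fun K _ => Finset.sum_nonneg fun R _ =>
      Finset.sum_nonneg fun k _ => Finset.sum_nonneg fun r _ => hnn K R _ _ ht hθ hφ)
  · refine ShiftBounded.sum hI fun K hK => ShiftBounded.sum hI' fun R hR =>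
      ShiftBounded.sum Finset.nonempty_range_add_one fun k hk =>
        ShiftBounded.sum Finset.nonempty_range_add_one fun r hr => ?_
    refine shiftBounded_upsTerm (hμ K) (hν R) A s _ _ fun t θ φ ht hθ hφ => ?_
    have z : 0 ∈ Finset.range (N + 1) := by simp
    have z' : 0 ∈ Finset.range (N' + 1) := by simp
    exact ⟨hle K R k r hK hR hk hr ht hθ hφ, hle K R k 0 hK hR hk z' ht hθ hφ,
      hle K R 0 r hK hR z hr ht hθ hφ, hle K R 0 0 hK hR z z' ht hθ hφ⟩

lemma shiftBounded_Ups {α β : ℝ} (W s : ℝ) (hα : -1 < α) (hβ : -1 < β) :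
    ShiftBounded (Ups α β W s) (Ups α β W s) := by
  have e : Ups α β W s = fun t θ φ => Ups α β W s t θ φ := rfl
  rw [e]
  unfold Ups
  split_ifs with h1 h2 h2
  · have := isFiniteMeasure_jacobiPi h1
    have := isFiniteMeasure_jacobiPi h2
    have h := shiftBounded_upsTerm (ae_jacobiPi_mem_Icc α) (ae_jacobiPi_mem_Icc β)
      (α + β + 3 / 2 + W / 4) s 0 0
      (g := upsTerm (jacobiPi α) (jacobiPi β) (α + β + 3 / 2 + W / 4) s 0 0)
      fun _ _ _ _ _ _ => ⟨le_rfl, le_rfl, le_rfl, le_rfl⟩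
    simpa [upsTerm, ShiftBounded] using h
  · have h := shiftBounded_one_add_sum (Finset.singleton_nonempty 0)
      (Finset.nonempty_range_add_one (n := 1)) (N := 0) (N' := 2)
      (fun _ => jacobiPi α) (jacobiPiK β) (fun _ => isFiniteMeasure_jacobiPi h1)
      (isFiniteMeasure_jacobiPiK hβ) (fun _ => ae_jacobiPi_mem_Icc α) (ae_jacobiPiK_mem_Icc β)
      (α + β + 3 / 2 + W / 4) s
    simpa only [upsTerm, Finset.sum_singleton, zero_add, Finset.range_one, mul_zero, pow_zero,
      one_mul, Nat.cast_zero, zero_div, add_zero, Nat.reduceAdd] using h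
  · have h := shiftBounded_one_add_sum (Finset.nonempty_range_add_one (n := 1))
      (Finset.singleton_nonempty 0) (N := 2) (N' := 0)
      (jacobiPiK α) (fun _ => jacobiPi β) (isFiniteMeasure_jacobiPiK hα)
      (fun _ => isFiniteMeasure_jacobiPi h2) (ae_jacobiPiK_mem_Icc α)
      (fun _ => ae_jacobiPi_mem_Icc β) (α + β + 3 / 2 + W / 4) s
    simpa only [upsTerm, Finset.sum_singleton, zero_add, Finset.range_one, mul_zero, pow_zero,
      mul_one, Nat.cast_zero, zero_div, add_zero, Nat.reduceAdd] using h
  · exact shiftBounded_one_add_sum (Finset.nonempty_range_add_one (n := 1))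
      (Finset.nonempty_range_add_one (n := 1)) (N := 2) (N' := 2) (jacobiPiK α) (jacobiPiK β) (isFiniteMeasure_jacobiPiK hα)
      (isFiniteMeasure_jacobiPiK hβ) (ae_jacobiPiK_mem_Icc α) (ae_jacobiPiK_mem_Icc β)
      (α + β + 3 / 2 + W / 4) s

theorem stmt_6 (α β W s : ℝ) (hα : -1 < α) (hβ : -1 < β) :
    ∃ C : ℝ, 0 < C ∧
      ∀ η t θ φ : ℝ, |η| < t → t ∈ Ioc (0 : ℝ) π →
        θ ∈ Ioo (0 : ℝ) π → φ ∈ Ioo (0 : ℝ) π → θ + η ∈ Ioo (0 : ℝ) π →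
          Ups α β W s t (θ + η) φ ≤ C * Ups α β W s t θ φ := by
  obtain ⟨D, hD, h⟩ := shiftBounded_Ups W s hα hβ
  exact ⟨D, hD, fun η t θ φ hη _ hθ hφ hθη => h η t θ φ hη hθ hφ hθη⟩
end

section
/- For each fixed κ ≥ 0 there exists a constant C > 0 such that for all (η,t) ∈ Γ and all θ, φ ∈ (0,π) with θ+η ∈ (0,π): ( cos((θ+η)/2) + cos(φ/2) )^κ ≤ C [ ( cos(θ/2) + cos(φ/2) )^κ + t^κ ]. -/
open Real Set

/-- A quasi-triangle inequality for nonnegative real powers. -/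
theorem rpow_add_le_two_rpow_mul {a b κ : ℝ} (ha : 0 ≤ a) (hb : 0 ≤ b) (hκ : 0 ≤ κ) :
    (a + b) ^ κ ≤ 2 ^ κ * (a ^ κ + b ^ κ) := by
  have key : (a + b) ^ κ ≤ 2 ^ κ * (max a b) ^ κ := by
    rw [← Real.mul_rpow zero_le_two (le_max_of_le_left ha)]
    exact Real.rpow_le_rpow (add_nonneg ha hb)
      (by linarith [le_max_left a b, le_max_right a b]) hκ
  refine key.trans (mul_le_mul_of_nonneg_left ?_ (by positivity))
  have h₁ := Real.rpow_nonneg ha κ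
  have h₂ := Real.rpow_nonneg hb κ
  rcases max_choice a b with h | h <;> rw [h] <;> linarith

theorem stmt_9 (κ : ℝ) (hκ : 0 ≤ κ) :
    ∃ C : ℝ, 0 < C ∧
      ∀ η t θ φ : ℝ, |η| < t → θ ∈ Ioo (0 : ℝ) π → φ ∈ Ioo (0 : ℝ) π →
        θ + η ∈ Ioo (0 : ℝ) π →
          (Real.cos ((θ + η) / 2) + Real.cos (φ / 2)) ^ κ
            ≤ C * ((Real.cos (θ / 2) + Real.cos (φ / 2)) ^ κ + t ^ κ) := by
  refine ⟨2 ^ κ, by positivity, fun η t θ φ hη hθ hφ hθη => ?_⟩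
  have cos_half_nonneg : ∀ x ∈ Ioo (0 : ℝ) π, 0 ≤ Real.cos (x / 2) := fun x hx =>
    Real.cos_nonneg_of_mem_Icc ⟨by linarith [hx.1, Real.pi_pos], by linarith [hx.2]⟩
  have h₁ := cos_half_nonneg θ hθ
  have h₂ := cos_half_nonneg φ hφ
  have h₃ := cos_half_nonneg (θ + η) hθη
  have hη₀ := abs_nonneg η
  have hlip := (le_abs_self _).trans (Real.abs_cos_sub_cos_le ((θ + η) / 2) (θ / 2))
  rw [show (θ + η) / 2 - θ / 2 = η / 2 by ring, abs_div, abs_two] at hlip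
  exact (Real.rpow_le_rpow (add_nonneg h₃ h₂) (by linarith) hκ).trans
    (rpow_add_le_two_rpow_mul (add_nonneg h₁ h₂) (hη₀.trans hη.le) hκ)
end

section
/- Let α, β > −1 and let γ ∈ (0,1/2] satisfy γ < min(α,β)+1. Then there exists a constant C > 0 such that for all t ∈ (0,π] and all θ, θ' ∈ (0,π) with |θ−θ'| ≤ t: μ_{α,β}( (min(θ,θ')−t, max(θ,θ')−t) ∩ (0,π) ) ≤ C (|θ−θ'|/t)^{2γ} · μ_{α,β}(B(θ',t)). -/
open Real Set MeasureTheory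

/-- The Jacobi measure `μ_{α,β}` on `(0,π)` with density
`(sin(θ/2))^{2α+1} (cos(θ/2))^{2β+1}`. -/
noncomputable def jacobiMeasure (α β : ℝ) : Measure ℝ :=
  (volume.restrict (Ioo 0 π)).withDensity
    (fun θ => ENNReal.ofReal ((Real.sin (θ / 2)) ^ (2 * α + 1) * (Real.cos (θ / 2)) ^ (2 * β + 1)))

/-- The ball `B(θ,r) = (θ−r, θ+r) ∩ (0,π)`. -/
def jacobiBall (θ r : ℝ) : Set ℝ := Ioo (θ - r) (θ + r) ∩ Ioo 0 π

lemma rpow_le_of_comparable {K x y : ℝ} (c : ℝ) (hK : 1 ≤ K) (hx : 0 < x) (hy : 0 < y)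
    (h₁ : x ≤ K * y) (h₂ : y ≤ K * x) : x ^ c ≤ K ^ |c| * y ^ c := by
  have hK₀ : 0 < K := by linarith
  rcases le_total 0 c with hc | hc
  · rw [abs_of_nonneg hc, ← Real.mul_rpow hK₀.le hy.le]
    exact Real.rpow_le_rpow hx.le h₁ hc
  · rw [abs_of_nonpos hc, Real.rpow_neg hK₀.le, ← Real.inv_rpow hK₀.le,
      ← Real.mul_rpow (inv_pos.2 hK₀).le hy.le]
    refine Real.rpow_le_rpow_of_nonpos (by positivity) ?_ hc
    rw [inv_mul_le_iff₀ hK₀]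
    exact h₂

lemma sin_half_bounds {x : ℝ} (hx₀ : 0 < x) (hx : x < π) :
    x / 4 ≤ Real.sin (x / 2) ∧ Real.sin (x / 2) ≤ x := by
  constructor
  · have h := Real.mul_le_sin (x := x / 2) (by linarith) (by linarith)
    have h4 : (1 : ℝ) / 4 ≤ 1 / π :=
      one_div_le_one_div_of_le Real.pi_pos Real.pi_le_four
    have : x * (1 / 4) ≤ x * (1 / π) := by gcongr
    have e : 2 / π * (x / 2) = x * (1 / π) := by ring
    linarith
  · have := Real.sin_le (x := x / 2) (by linarith)
    linarith

lemma cos_half_bounds {x : ℝ} (hx₀ : 0 < x) (hx : x < π) :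
    (π - x) / 4 ≤ Real.cos (x / 2) ∧ Real.cos (x / 2) ≤ π - x := by
  have h := sin_half_bounds (x := π - x) (by linarith) (by linarith)
  rwa [show (π - x) / 2 = π / 2 - x / 2 by ring, Real.sin_pi_div_two_sub] at h

lemma rpow_sub_rpow_le {e p q : ℝ} (he : 0 < e) (hp : 0 ≤ p) (hq : 0 < q) (hpq : p ≤ q) :
    q ^ e - p ^ e ≤ (1 + e) * (q ^ (e - 1) * (q - p)) := by
  obtain ⟨r, rfl⟩ : ∃ r, p = r * q := ⟨p / q, by field_simp⟩
  have hr₀ : 0 ≤ r := nonneg_of_mul_nonneg_left hp hq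
  have hr₁ : r ≤ 1 := by
    by_contra! h
    nlinarith
  have key : 1 - r ^ e ≤ (1 + e) * (1 - r) := by
    rcases le_total e 1 with h | h
    · have : r ≤ r ^ e := Real.self_le_rpow_of_le_one hr₀ hr₁ h
      nlinarith
    · have := one_add_mul_self_le_rpow_one_add (s := r - 1) (by linarith) h
      rw [show 1 + (r - 1) = r by ring] at this
      nlinarith
  rw [Real.mul_rpow hr₀ hq.le]
  have hqe : q ^ e = q ^ (e - 1) * q := by
    rw [← Real.rpow_add_one hq.ne', sub_add_cancel]
  have hpos : 0 < q ^ e := by positivity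
  calc q ^ e - r ^ e * q ^ e = q ^ e * (1 - r ^ e) := by ring
    _ ≤ q ^ e * ((1 + e) * (1 - r)) := by gcongr
    _ = _ := by rw [hqe]; ring

lemma lintegral_rpow_Ioo_le {a p q : ℝ} (ha : -1 < a) (hp : 0 ≤ p) (hq : 0 < q) (hpq : p ≤ q) :
    ∫⁻ x in Ioo p q, ENNReal.ofReal (x ^ a)
      ≤ ENNReal.ofReal ((a + 2) / (a + 1) * (q ^ a * (q - p))) := by
  have hint : IntervalIntegrable (fun x : ℝ => x ^ a) volume p q :=
    intervalIntegral.intervalIntegrable_rpow' ha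
  have hi : IntegrableOn (fun x : ℝ => x ^ a) (Ioc p q) :=
    (intervalIntegrable_iff_integrableOn_Ioc_of_le hpq).1 hint
  rw [setLIntegral_congr Ioo_ae_eq_Ioc, ← ofReal_integral_eq_lintegral_ofReal hi,
    ← intervalIntegral.integral_of_le hpq, integral_rpow (Or.inl ha)]
  · apply ENNReal.ofReal_le_ofReal
    have ha' : 0 < a + 1 := by linarith
    have h := rpow_sub_rpow_le ha' hp hq hpq
    rw [add_sub_cancel_right] at h
    rw [div_mul_eq_mul_div]
    gcongr
    linarith
  · filter_upwards [ae_restrict_mem measurableSet_Ioc] with x hx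
    exact Real.rpow_nonneg (hp.trans hx.1.le) _

lemma rpow_mul_length_le {a c q s d t : ℝ} (hc₀ : 0 ≤ c) (hc₁ : c ≤ 1) (hca : c ≤ a + 1)
    (hq : 0 < q) (hs : 0 ≤ s) (hsq : s ≤ q) (hsd : s ≤ d) (hdt : d ≤ t) (ht : 0 < t) :
    q ^ a * s ≤ 2 ^ |a| * ((d / t) ^ c * (t * (q + t) ^ a)) := by
  have hd : 0 ≤ d := hs.trans hsd
  have hlen : s ≤ (d / t) ^ c * t := by
    have h : d / t ≤ (d / t) ^ c :=
      Real.self_le_rpow_of_le_one (by positivity) ((div_le_one ht).2 hdt) hc₁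
    calc s ≤ d / t * t := by rwa [div_mul_cancel₀ _ ht.ne']
      _ ≤ _ := by gcongr
  have h2 : (1 : ℝ) ≤ 2 ^ |a| := Real.one_le_rpow (by norm_num) (abs_nonneg a)
  rcases le_total t q with htq | htq
  · have h := rpow_le_of_comparable a one_le_two hq (by linarith : 0 < q + t)
      (by linarith) (by linarith)
    calc q ^ a * s ≤ (2 ^ |a| * (q + t) ^ a) * ((d / t) ^ c * t) := by gcongr
      _ = _ := by ring
  · have h := rpow_le_of_comparable a one_le_two ht (by linarith : 0 < q + t)
      (by linarith) (by linarith)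
    have h₁ : s / q ≤ (s / q) ^ c :=
      Real.self_le_rpow_of_le_one (by positivity) ((div_le_one hq).2 hsq) hc₁
    calc q ^ a * s = q ^ (a + 1) * (s / q) := by
          rw [Real.rpow_add_one hq.ne']; field_simp
      _ ≤ q ^ (a + 1) * (s / q) ^ c := by gcongr
      _ = q ^ (a + 1 - c) * s ^ c := by
          rw [Real.rpow_sub hq, Real.div_rpow hs hq.le]; ring
      _ ≤ t ^ (a + 1 - c) * d ^ c := by
          gcongr
      _ = (d / t) ^ c * (t * t ^ a) := by
          rw [Real.rpow_sub ht, Real.div_rpow hd ht.le, Real.rpow_add_one ht.ne']; ring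
      _ ≤ (d / t) ^ c * (t * (2 ^ |a| * (q + t) ^ a)) := by gcongr
      _ = _ := by ring

lemma jacobiMeasure_apply (α β : ℝ) {s : Set ℝ} (hs : MeasurableSet s) (hsub : s ⊆ Ioo 0 π) :
    jacobiMeasure α β s = ∫⁻ x in s, ENNReal.ofReal
      ((Real.sin (x / 2)) ^ (2 * α + 1) * (Real.cos (x / 2)) ^ (2 * β + 1)) := by
  rw [jacobiMeasure, withDensity_apply _ hs, Measure.restrict_restrict hs,
    inter_eq_self_of_subset_left hsub]

lemma jacobiMeasure_Ioo_le {α β p q : ℝ} (hα : -1 < α) (hp : 0 ≤ p) (hpq : p < q)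
    (hq : q < π) (hlen : q - p ≤ π - q) :
    jacobiMeasure α β (Ioo p q) ≤ ENNReal.ofReal
      (4 ^ |2 * α + 1| * 4 ^ |2 * β + 1| * ((2 * α + 3) / (2 * α + 2)) *
        (q ^ (2 * α + 1) * (q - p)) * (π - q) ^ (2 * β + 1)) := by
  have hπq : 0 < π - q := by linarith
  rw [jacobiMeasure_apply α β measurableSet_Ioo (Ioo_subset_Ioo hp hq.le)]
  calc ∫⁻ x in Ioo p q, ENNReal.ofReal
        ((Real.sin (x / 2)) ^ (2 * α + 1) * (Real.cos (x / 2)) ^ (2 * β + 1))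
      ≤ ∫⁻ x in Ioo p q, ENNReal.ofReal
          (4 ^ |2 * α + 1| * 4 ^ |2 * β + 1| * (π - q) ^ (2 * β + 1)) *
          ENNReal.ofReal (x ^ (2 * α + 1)) := by
        refine setLIntegral_mono' measurableSet_Ioo fun x hx => ?_
        have hx₀ : 0 < x := hp.trans_lt hx.1
        have hxπ : x < π := hx.2.trans hq
        have hs := sin_half_bounds hx₀ hxπ
        have hc := cos_half_bounds hx₀ hxπ
        have hx1 := hx.1
        have hx2 := hx.2
        rw [← ENNReal.ofReal_mul (by positivity)]
        apply ENNReal.ofReal_le_ofReal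
        have h₁ := rpow_le_of_comparable (2 * α + 1) (by norm_num : (1 : ℝ) ≤ 4)
          (by linarith : 0 < Real.sin (x / 2)) hx₀ (by linarith) (by linarith)
        have h₂ := rpow_le_of_comparable (2 * β + 1) (by norm_num : (1 : ℝ) ≤ 4)
          (by linarith : 0 < Real.cos (x / 2)) hπq (by linarith) (by linarith)
        have h₃ : 0 ≤ Real.cos (x / 2) ^ (2 * β + 1) := Real.rpow_nonneg (by linarith) _
        calc _ ≤ (4 ^ |2 * α + 1| * x ^ (2 * α + 1)) *
              (4 ^ |2 * β + 1| * (π - q) ^ (2 * β + 1)) := by gcongr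
          _ = _ := by ring
    _ ≤ ENNReal.ofReal (4 ^ |2 * α + 1| * 4 ^ |2 * β + 1| * (π - q) ^ (2 * β + 1)) *
          ENNReal.ofReal ((2 * α + 1 + 2) / (2 * α + 1 + 1) *
            (q ^ (2 * α + 1) * (q - p))) := by
        rw [lintegral_const_mul' _ _ ENNReal.ofReal_ne_top]
        gcongr
        exact lintegral_rpow_Ioo_le (by linarith) hp (by linarith) hpq.le
    _ = _ := by
        rw [← ENNReal.ofReal_mul (by positivity)]
        congr 1
        rw [show 2 * α + 1 + 2 = 2 * α + 3 by ring, show 2 * α + 1 + 1 = 2 * α + 2 by ring]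
        ring

lemma le_jacobiMeasure_Ioo {α β q t : ℝ} (hq : 0 < q) (ht : 0 < t) (hqt : q + t < π) :
    ENNReal.ofReal (t * (q + t) ^ (2 * α + 1) * (π - q) ^ (2 * β + 1)) ≤
      ENNReal.ofReal (4 * 16 ^ |2 * α + 1| * 16 ^ |2 * β + 1|) *
        jacobiMeasure α β (Ioo q (q + t)) := by
  have hπq : 0 < π - q := by linarith
  have hsub : Ioo (q + t / 4) (q + t / 2) ⊆ Ioo q (q + t) :=
    Ioo_subset_Ioo (by linarith) (by linarith)
  have hsub' : Ioo (q + t / 4) (q + t / 2) ⊆ Ioo 0 π :=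
    hsub.trans (Ioo_subset_Ioo hq.le hqt.le)
  refine le_trans ?_ (mul_le_mul_right (measure_mono hsub) _)
  rw [jacobiMeasure_apply α β measurableSet_Ioo hsub',
    ← lintegral_const_mul' _ _ ENNReal.ofReal_ne_top]
  calc ENNReal.ofReal (t * (q + t) ^ (2 * α + 1) * (π - q) ^ (2 * β + 1))
      = ∫⁻ _ in Ioo (q + t / 4) (q + t / 2),
          ENNReal.ofReal (4 * (q + t) ^ (2 * α + 1) * (π - q) ^ (2 * β + 1)) := by
        rw [setLIntegral_const, Real.volume_Ioo, ← ENNReal.ofReal_mul (by positivity)]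
        congr 1
        ring
    _ ≤ _ := by
        refine setLIntegral_mono' measurableSet_Ioo fun x hx => ?_
        have hx1 := hx.1
        have hx2 := hx.2
        have hs := sin_half_bounds (hsub' hx).1 (hsub' hx).2
        have hc := cos_half_bounds (hsub' hx).1 (hsub' hx).2
        rw [← ENNReal.ofReal_mul (by positivity)]
        apply ENNReal.ofReal_le_ofReal
        have h₁ := rpow_le_of_comparable (2 * α + 1) (by norm_num : (1 : ℝ) ≤ 16)
          (by linarith : 0 < q + t) (by linarith : 0 < Real.sin (x / 2))
          (by linarith) (by linarith)
        have h₂ := rpow_le_of_comparable (2 * β + 1) (by norm_num : (1 : ℝ) ≤ 16)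
          hπq (by linarith : 0 < Real.cos (x / 2)) (by linarith) (by linarith)
        have h₃ : 0 ≤ (π - q) ^ (2 * β + 1) := by positivity
        have h₄ : 0 ≤ Real.sin (x / 2) ^ (2 * α + 1) := Real.rpow_nonneg (by linarith) _
        calc _ ≤ 4 * (16 ^ |2 * α + 1| * Real.sin (x / 2) ^ (2 * α + 1)) *
              (16 ^ |2 * β + 1| * Real.cos (x / 2) ^ (2 * β + 1)) := by gcongr
          _ = _ := by ring

theorem stmt_11 (α β γ : ℝ) (hα : -1 < α) (hβ : -1 < β)
    (hγ₀ : 0 < γ) (hγ₁ : γ ≤ 1 / 2) (hγ : γ < min α β + 1) :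
    ∃ C : ℝ, 0 < C ∧
      ∀ t : ℝ, t ∈ Ioc (0 : ℝ) π → ∀ θ ∈ Ioo (0 : ℝ) π, ∀ θ' ∈ Ioo (0 : ℝ) π,
        |θ - θ'| ≤ t →
          jacobiMeasure α β (Ioo (min θ θ' - t) (max θ θ' - t) ∩ Ioo 0 π)
            ≤ ENNReal.ofReal (C * (|θ - θ'| / t) ^ (2 * γ)) *
                jacobiMeasure α β (jacobiBall θ' t) := by
  have hα₂ : 0 < 2 * α + 2 := by linarith
  have hα₃ : 0 < 2 * α + 3 := by linarith
  set A : ℝ := 4 ^ |2 * α + 1| * 4 ^ |2 * β + 1| * ((2 * α + 3) / (2 * α + 2)) with hA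
  set D : ℝ := 4 * 16 ^ |2 * α + 1| * 16 ^ |2 * β + 1| with hD
  have hA₀ : 0 < A := by positivity
  have hD₀ : 0 < D := by positivity
  refine ⟨A * 2 ^ |2 * α + 1| * D, by positivity, ?_⟩
  rintro t ⟨ht, -⟩ θ hθ θ' hθ' hd
  have hdist : max θ θ' - min θ θ' = |θ - θ'| := by
    rw [max_sub_min_eq_abs, abs_sub_comm]
  have hMπ : max θ θ' < π := max_lt hθ.2 hθ'.2
  have hmin := min_le_right θ θ'
  have hmax := le_max_right θ θ'
  set d := |θ - θ'| with hd_def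
  set M := max θ θ'
  set m := min θ θ'
  have hd₀ : 0 ≤ d := abs_nonneg _
  set q := M - t with hq_def
  set p := max (m - t) 0 with hp_def
  have hp₀ : 0 ≤ p := le_max_right _ _
  have hp₁ : m - t ≤ p := le_max_left _ _
  have hsub : Ioo (m - t) q ∩ Ioo 0 π ⊆ Ioo p q := fun x hx =>
    ⟨max_lt hx.1.1 hx.2.1, hx.1.2⟩
  refine (measure_mono hsub).trans ?_
  rcases le_or_gt q p with hqp | hpq
  · simp [Ioo_eq_empty_of_le hqp]
  have hq₀ : 0 < q := hp₀.trans_lt hpq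
  have hπq : 0 < π - q := by linarith
  have hball : Ioo q (q + t) ⊆ jacobiBall θ' t := fun x hx =>
    ⟨⟨by linarith [hx.1], by linarith [hx.2]⟩, by linarith [hx.1], by linarith [hx.2]⟩
  have hc : 2 * γ ≤ 2 * α + 1 + 1 := by linarith [min_le_left α β]
  have hlen := rpow_mul_length_le (a := 2 * α + 1) (c := 2 * γ) (q := q) (s := q - p) (d := d)
    (t := t) (by linarith) (by linarith) hc hq₀ (by linarith) (by linarith) (by linarith) hd ht
  calc jacobiMeasure α β (Ioo p q)
      ≤ ENNReal.ofReal (A * (q ^ (2 * α + 1) * (q - p)) * (π - q) ^ (2 * β + 1)) :=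
        jacobiMeasure_Ioo_le hα hp₀ hpq (by linarith) (by linarith)
    _ ≤ ENNReal.ofReal (A * (2 ^ |2 * α + 1| * ((d / t) ^ (2 * γ) *
          (t * (q + t) ^ (2 * α + 1)))) * (π - q) ^ (2 * β + 1)) := by
        gcongr
    _ = ENNReal.ofReal (A * 2 ^ |2 * α + 1| * (d / t) ^ (2 * γ)) *
          ENNReal.ofReal (t * (q + t) ^ (2 * α + 1) * (π - q) ^ (2 * β + 1)) := by
        rw [← ENNReal.ofReal_mul (by positivity)]
        congr 1
        ring
    _ ≤ ENNReal.ofReal (A * 2 ^ |2 * α + 1| * (d / t) ^ (2 * γ)) *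
          (ENNReal.ofReal D * jacobiMeasure α β (Ioo q (q + t))) := by
        gcongr
        exact le_jacobiMeasure_Ioo hq₀ ht (by linarith)
    _ ≤ ENNReal.ofReal (A * 2 ^ |2 * α + 1| * (d / t) ^ (2 * γ)) *
          (ENNReal.ofReal D * jacobiMeasure α β (jacobiBall θ' t)) := by
        gcongr
    _ = _ := by
        rw [← mul_assoc, ← ENNReal.ofReal_mul (by positivity)]
        congr 2
        ring
end

section
/- There exist constants c, C > 0 such that for all θ, θ̃, φ ∈ (0,π) with |θ−φ| > 2|θ−θ̃|: c ( sin(θ/2) + sin(φ/2) ) ≤ sin(θ̃/2) + sin(φ/2) ≤ C ( sin(θ/2) + sin(φ/2) ) and c ( cos(θ/2) + cos(φ/2) ) ≤ cos(θ̃/2) + cos(φ/2) ≤ C ( cos(θ/2) + cos(φ/2) ). -/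
open Real Set

/-- If `2 * |a - t| < |a - f|` in the first quadrant, then `sin t + sin f` and `sin a + sin f` are
comparable. -/
theorem sin_add_sin_comparable {a t f : ℝ} (ha : a ∈ Ioo 0 (π / 2)) (ht : t ∈ Ioo 0 (π / 2))
    (hf : f ∈ Ioo 0 (π / 2)) (h : 2 * |a - t| < |a - f|) :
    π⁻¹ * (sin a + sin f) ≤ sin t + sin f ∧ sin t + sin f ≤ π * (sin a + sin f) := by
  obtain ⟨ha0, ha1⟩ := ha
  obtain ⟨ht0, ht1⟩ := ht
  obtain ⟨hf0, hf1⟩ := hf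
  have hsum : |a - f| ≤ a + f := abs_le.2 ⟨by linarith, by linarith⟩
  obtain ⟨hlow, hupp⟩ := abs_le.1 (by linarith : |a - t| ≤ (a + f) / 2)
  have jordan : ∀ x, 0 < x → x < π / 2 → 2 * x ≤ π * sin x := fun x h0 h1 => by
    have hx := mul_le_mul_of_nonneg_left (mul_le_sin h0.le h1.le) pi_pos.le
    rwa [← mul_assoc, mul_div_cancel₀ _ pi_ne_zero] at hx
  have hja := jordan a ha0 ha1
  have hjt := jordan t ht0 ht1
  have hjf := jordan f hf0 hf1
  have hsa := sin_le ha0.le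
  have hst := sin_le ht0.le
  have hsf := sin_le hf0.le
  constructor
  · rw [inv_mul_le_iff₀ pi_pos]
    linarith
  · linarith

theorem stmt_14 :
    ∃ c C : ℝ, 0 < c ∧ 0 < C ∧
      ∀ θ θt φ : ℝ, θ ∈ Ioo (0 : ℝ) π → θt ∈ Ioo (0 : ℝ) π → φ ∈ Ioo (0 : ℝ) π →
        |θ - φ| > 2 * |θ - θt| →
          (c * (Real.sin (θ / 2) + Real.sin (φ / 2)) ≤ Real.sin (θt / 2) + Real.sin (φ / 2) ∧
            Real.sin (θt / 2) + Real.sin (φ / 2) ≤ C * (Real.sin (θ / 2) + Real.sin (φ / 2))) ∧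
          (c * (Real.cos (θ / 2) + Real.cos (φ / 2)) ≤ Real.cos (θt / 2) + Real.cos (φ / 2) ∧
            Real.cos (θt / 2) + Real.cos (φ / 2) ≤ C * (Real.cos (θ / 2) + Real.cos (φ / 2))) := by
  refine ⟨π⁻¹, π, inv_pos.2 pi_pos, pi_pos, ?_⟩
  rintro θ θt φ ⟨hθ0, hθ1⟩ ⟨hθt0, hθt1⟩ ⟨hφ0, hφ1⟩ h
  have half : ∀ x y : ℝ, |x / 2 - y / 2| = |x - y| / 2 := fun x y => by
    rw [← sub_div, abs_div, abs_two]
  constructor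
  · apply sin_add_sin_comparable ⟨by linarith, by linarith⟩ ⟨by linarith, by linarith⟩
      ⟨by linarith, by linarith⟩
    rw [half, half]
    linarith
  · simp only [← sin_pi_div_two_sub]
    apply sin_add_sin_comparable ⟨by linarith, by linarith⟩ ⟨by linarith, by linarith⟩
      ⟨by linarith, by linarith⟩
    rw [sub_sub_sub_cancel_left, sub_sub_sub_cancel_left, half, half, abs_sub_comm θt,
      abs_sub_comm φ]
    linarith
end
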